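/- arXiv:2410.14011 — 2 statements merged into one kernel-verified Lean document; each statement's English description precedes it below -/
import Mathlib

section
/- There exist real constants ν₁ ≥ 0 and ν₂, ν₃, ν₄, ν₅, ν₆ > 0 such that the function g : ℝ × ℝ → ℝ defined by g(p, l) = (ν₁ + ν₂ p) · ( 1 − (1 − 1/(1 + ν₃·exp(−ν₄ p))) · (1 − 1/(1 + ν₅·exp(−ν₆ l))) ) is neither convex nor concave on the set [0, ∞) × [0, ∞). -/
theorem stmt_3 :
    ∃ ν₁ ν₂ ν₃ ν₄ ν₅ ν₆ : ℝ, 0 ≤ ν₁ ∧ 0 < ν₂ ∧ 0 < ν₃ ∧ 0 < ν₄ ∧ 0 < ν₅ ∧ 0 < ν₆ ∧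
      ¬ ConvexOn ℝ (Set.Ici (0:ℝ) ×ˢ Set.Ici (0:ℝ))
        (fun q : ℝ × ℝ =>
          (ν₁ + ν₂ * q.1) *
            (1 - (1 - 1 / (1 + ν₃ * Real.exp (-(ν₄ * q.1)))) *
                 (1 - 1 / (1 + ν₅ * Real.exp (-(ν₆ * q.2)))))) ∧
      ¬ ConcaveOn ℝ (Set.Ici (0:ℝ) ×ˢ Set.Ici (0:ℝ))
        (fun q : ℝ × ℝ =>
          (ν₁ + ν₂ * q.1) *
            (1 - (1 - 1 / (1 + ν₃ * Real.exp (-(ν₄ * q.1)))) *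
                 (1 - 1 / (1 + ν₅ * Real.exp (-(ν₆ * q.2)))))) := by
  have h (n : ℕ) : Real.exp (-(Real.log 2 * n)) = (1 / 2) ^ n := by
    rw [Real.exp_neg, mul_comm, Real.exp_nat_mul, Real.exp_log two_pos, one_div, inv_pow]
  have h1 := h 1
  have h2 := h 2
  have h4 := h 4
  have h5 := h 5
  have h6 := h 6
  push_cast at h1 h2 h4 h5 h6
  refine ⟨1, 1, 1, 1, 8, Real.log 2, by norm_num, by norm_num, by norm_num, by norm_num,
    by norm_num, Real.log_pos one_lt_two, fun hconv => ?_, fun hconc => ?_⟩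
  · have key := hconv.2 (show ((0, 4) : ℝ × ℝ) ∈ _ by simp) (show ((0, 6) : ℝ × ℝ) ∈ _ by simp)
      (show (0 : ℝ) ≤ 1 / 2 by norm_num) (show (0 : ℝ) ≤ 1 / 2 by norm_num) (by norm_num)
    have hmid : (1 / 2 : ℝ) • ((0, 4) : ℝ × ℝ) + (1 / 2 : ℝ) • ((0, 6) : ℝ × ℝ) = (0, 5) := by
      ext <;> norm_num
    rw [hmid] at key
    simp only [h4, h5, h6, mul_zero, neg_zero, Real.exp_zero, smul_eq_mul] at key
    norm_num at key
  · have key := hconc.2 (show ((0, 0) : ℝ × ℝ) ∈ _ by simp) (show ((0, 2) : ℝ × ℝ) ∈ _ by simp)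
      (show (0 : ℝ) ≤ 1 / 2 by norm_num) (show (0 : ℝ) ≤ 1 / 2 by norm_num) (by norm_num)
    have hmid : (1 / 2 : ℝ) • ((0, 0) : ℝ × ℝ) + (1 / 2 : ℝ) • ((0, 2) : ℝ × ℝ) = (0, 1) := by
      ext <;> norm_num
    rw [hmid] at key
    simp only [h1, h2, mul_zero, neg_zero, Real.exp_zero, smul_eq_mul] at key
    norm_num at key
end

section
/- Let λ₀ : ℝ → ℝ be interval-integrable on [0, t] and on [t, t + δ] (with respect to Lebesgue measure), where t ≥ 0 and δ ≥ 0, and suppose ∫_t^{t+δ} λ₀(z) dz > 0. Let c ∈ ℝ, define the hazard rate λ(z) = λ₀(z)·exp(c) and the reliability function Re(s) = exp(−∫₀^s λ(z) dz), and set α = log(∫_t^{t+δ} λ₀(z) dz). Then Re(t + δ) / Re(t) = exp(−exp(α + c)). -/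
open MeasureTheory intervalIntegral

theorem stmt_7 (lam₀ : ℝ → ℝ) (t δ : ℝ) (ht : 0 ≤ t) (hδ : 0 ≤ δ)
    (h₁ : IntervalIntegrable lam₀ volume 0 t)
    (h₂ : IntervalIntegrable lam₀ volume t (t + δ))
    (hpos : 0 < ∫ z in t..(t + δ), lam₀ z)
    (c : ℝ)
    (lam : ℝ → ℝ) (hlam : ∀ z, lam z = lam₀ z * Real.exp c)
    (Re : ℝ → ℝ) (hRe : ∀ s, Re s = Real.exp (-∫ z in (0:ℝ)..s, lam z))
    (α : ℝ) (hα : α = Real.log (∫ z in t..(t + δ), lam₀ z)) :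
    Re (t + δ) / Re t = Real.exp (-Real.exp (α + c)) := by
  obtain rfl : lam = fun z => lam₀ z * Real.exp c := funext hlam
  rw [hRe, hRe, ← Real.exp_sub, hα, Real.exp_add, Real.exp_log hpos,
    intervalIntegral.integral_mul_const, intervalIntegral.integral_mul_const,
    ← intervalIntegral.integral_add_adjacent_intervals h₁ h₂]
  ring_nf
end
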